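/- Let X be a type and A a category with all finite colimits. For any assignment ob sending each element x of X to an object ob(x) of A, there exists a functor G : FinSet↓X ⥤ A that preserves finite colimits together with an isomorphism G(⟨x⟩) ≅ ob(x) for every x ∈ X. (FinSet↓X is the free category with finite colimits on the set X: the inclusion of generators extends to a finite-colimit-preserving functor.) -/

import Mathlib

open CategoryTheory

/-- An object of the category of finite sets over `X`: a finite type `F` with a map
`p : F → X`. -/
structure FinOver (X : Type) where
  F : Type
  [finF : Fintype F]
  p : F → X

attribute [instance] FinOver.finF

/-- A morphism of finite sets over `X`. -/
@[ext]
structure FinOverHom {X : Type} (A B : FinOver X) where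
  h : A.F → B.F
  comm : B.p ∘ h = A.p

/-- The category `FinSet↓X` of finite sets over `X`. -/
instance (X : Type) : Category (FinOver X) where
  Hom := FinOverHom
  id A := ⟨id, rfl⟩
  comp {A B C} φ φ' := ⟨φ'.h ∘ φ.h, by
    rw [← φ.comm, ← φ'.comm]
    rfl⟩
  id_comp φ := FinOverHom.ext rfl
  comp_id φ := FinOverHom.ext rfl
  assoc φ φ' φ'' := FinOverHom.ext rfl

/-- The generator of `FinSet↓X` corresponding to `x : X`: the one-point finite set
over `X` picking out `x`. -/
def FinOver.gen {X : Type} (x : X) : FinOver X := ⟨PUnit, fun _ => x⟩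

namespace FinOver

open Limits

variable {X : Type}

@[simp]
lemma id_h (B : FinOver X) : FinOverHom.h (𝟙 B) = id := rfl

@[simp]
lemma comp_h {B C D : FinOver X} (φ : B ⟶ C) (ψ : C ⟶ D) :
    FinOverHom.h (φ ≫ ψ) = FinOverHom.h ψ ∘ FinOverHom.h φ := rfl

lemma p_h {B C : FinOver X} (φ : B ⟶ C) (i : B.F) : C.p (FinOverHom.h φ i) = B.p i :=
  congrFun (FinOverHom.comm φ) i

/-- A small model of a finite type over `X` living in an arbitrary universe. -/
noncomputable def ofFinite {S : Type*} [Finite S] (q : S → X) : FinOver X :=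
  ⟨Fin (Nat.card S), q ∘ (Finite.equivFin S).symm⟩

/-- A map over `X` into a finite type `S`, as a morphism into its small model. -/
noncomputable def homOfFinite {S : Type*} [Finite S] (q : S → X) {B : FinOver X}
    (g : B.F → S) (hg : ∀ i, q (g i) = B.p i) : B ⟶ ofFinite q :=
  FinOverHom.mk (fun i => Finite.equivFin S (g i)) (by ext i; simp [ofFinite, hg])

section Colimit

variable {J : Type} [SmallCategory J] {K : J ⥤ FinOver X} {c : Cocone K}

/-- Colimits of finite sets over `X` have the uniqueness part of the universal property
with respect to all sets over `X`. -/
lemma colimit_funext (hc : IsColimit c) {S : Type*} (q : S → X) {g g' : c.pt.F → S}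
    (hg : ∀ i, q (g i) = c.pt.p i) (hg' : ∀ i, q (g' i) = c.pt.p i)
    (h : ∀ j i, g (FinOverHom.h (c.ι.app j) i) = g' (FinOverHom.h (c.ι.app j) i)) : g = g' := by
  let R : Set S := Set.range g ∪ Set.range g'
  have : Finite R := Set.Finite.to_subtype ((Set.finite_range g).union (Set.finite_range g'))
  let r : R → X := fun s => q s
  let φ : c.pt ⟶ ofFinite r := homOfFinite r (fun i => ⟨g i, Or.inl ⟨i, rfl⟩⟩) hg
  let φ' : c.pt ⟶ ofFinite r := homOfFinite r (fun i => ⟨g' i, Or.inr ⟨i, rfl⟩⟩) hg'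
  have e : φ = φ' := hc.hom_ext fun j => FinOverHom.ext (funext fun i =>
    congrArg (Finite.equivFin R) (Subtype.ext (h j i)))
  funext i
  exact congrArg Subtype.val ((Finite.equivFin R).injective (congrFun (congrArg FinOverHom.h e) i))

/-- Finite colimits of finite sets over `X` have the existence part of the universal property
with respect to all sets over `X`. -/
lemma exists_colimit_desc [Finite J] (hc : IsColimit c) {S : Type*} (q : S → X)
    (f : ∀ j, (K.obj j).F → S) (hf : ∀ j i, q (f j i) = (K.obj j).p i)
    (hnat : ∀ {j k} (u : j ⟶ k) i, f k (FinOverHom.h (K.map u) i) = f j i) :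
    ∃ g : c.pt.F → S, (∀ i, q (g i) = c.pt.p i) ∧
      ∀ j i, g (FinOverHom.h (c.ι.app j) i) = f j i := by
  let R : Set S := Set.range fun s : Σ j, (K.obj j).F => f s.1 s.2
  have : Finite R := (Set.finite_range _).to_subtype
  let r : R → X := fun s => q s
  let s : Cocone K :=
    { pt := ofFinite r
      ι :=
        { app := fun j => homOfFinite r (fun i => ⟨f j i, ⟨j, i⟩, rfl⟩) (hf j)
          naturality := fun j k u => FinOverHom.ext (funext fun i =>
            congrArg (Finite.equivFin R) (Subtype.ext (hnat u i))) } }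
  refine ⟨fun i => (Finite.equivFin R).symm (FinOverHom.h (hc.desc s) i),
    p_h (hc.desc s), fun j i => ?_⟩
  have e := congrFun (congrArg FinOverHom.h (hc.fac s j)) i
  have e' : FinOverHom.h (hc.desc s) (FinOverHom.h (c.ι.app j) i) =
    Finite.equivFin R ⟨f j i, ⟨j, i⟩, rfl⟩ := e
  exact congrArg Subtype.val (((Finite.equivFin R).symm_apply_eq).mpr e')

end Colimit

universe v u

lemma sigma_mk_eqToHom_comp {A : Type u} [Category.{v} A] {ob : X → A} {a : A} {x y : X} (h : x = y) (f : ob y ⟶ a) :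
    (⟨x, eqToHom (congrArg ob h) ≫ f⟩ : Σ x, (ob x ⟶ a)) = ⟨y, f⟩ := by
  subst h
  simp

variable {A : Type u} [Category.{v} A] [HasFiniteColimits A] (ob : X → A)

/-- The extension of `ob` sending `(F, p)` to the coproduct of the objects `ob (p i)`. -/
noncomputable def extend : FinOver X ⥤ A where
  obj B := ∐ fun i : B.F => ob (B.p i)
  map {B C} φ := Sigma.desc fun i =>
    eqToHom (congrArg ob (p_h φ i).symm) ≫ Sigma.ι (fun k => ob (C.p k)) (FinOverHom.h φ i)
  map_id B := by
    apply Sigma.hom_ext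
    intro i
    simp
  map_comp {B C D} φ ψ := by
    apply Sigma.hom_ext
    intro i
    simp

/-- The inclusion of a summand in a value of `extend ob`. -/
noncomputable def extendι (B : FinOver X) (i : B.F) : ob (B.p i) ⟶ (extend ob).obj B :=
  Sigma.ι (fun k => ob (B.p k)) i

lemma extendι_map {B C : FinOver X} (φ : B ⟶ C) (i : B.F) :
    extendι ob B i ≫ (extend ob).map φ =
      eqToHom (congrArg ob (p_h φ i).symm) ≫ extendι ob C (FinOverHom.h φ i) :=
  Sigma.ι_desc _ _

variable {ob}

lemma extend_hom_ext {B : FinOver X} {a : A} {s t : (extend ob).obj B ⟶ a}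
    (h : ∀ i, extendι ob B i ≫ s = extendι ob B i ≫ t) : s = t :=
  Sigma.hom_ext _ _ h

/-- The map over `X` corresponding to a morphism out of a value of `extend ob`. -/
noncomputable def components {B : FinOver X} {a : A} (t : (extend ob).obj B ⟶ a) (i : B.F) :
    Σ x, (ob x ⟶ a) :=
  ⟨B.p i, extendι ob B i ≫ t⟩

lemma components_injective {B : FinOver X} {a : A} :
    Function.Injective (components : ((extend ob).obj B ⟶ a) → B.F → Σ x, (ob x ⟶ a)) := by
  intro s t h
  exact extend_hom_ext fun i => eq_of_heq (Sigma.mk.inj (congrFun h i)).2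

lemma components_map_comp {B C : FinOver X} {a : A} (φ : B ⟶ C) (t : (extend ob).obj C ⟶ a)
    (i : B.F) : components ((extend ob).map φ ≫ t) i = components t (FinOverHom.h φ i) := by
  rw [components, ← Category.assoc, extendι_map, Category.assoc]
  exact sigma_mk_eqToHom_comp (p_h φ i).symm _

lemma exists_components_eq {B : FinOver X} {a : A} (g : B.F → Σ x, (ob x ⟶ a))
    (hg : ∀ i, (g i).1 = B.p i) : ∃ t : (extend ob).obj B ⟶ a, components t = g := by
  refine ⟨Sigma.desc fun i => eqToHom (congrArg ob (hg i).symm) ≫ (g i).2, funext fun i => ?_⟩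
  refine Eq.trans (congrArg (Sigma.mk _) (Sigma.ι_desc _ _)) ?_
  exact sigma_mk_eqToHom_comp (hg i).symm _

lemma exists_extend_desc {J : Type} [SmallCategory J] [Finite J] {K : J ⥤ FinOver X}
    {c : Cocone K} (hc : IsColimit c) (s : Cocone (K ⋙ extend ob)) :
    ∃ t : (extend ob).obj c.pt ⟶ s.pt, ∀ j, (extend ob).map (c.ι.app j) ≫ t = s.ι.app j := by
  obtain ⟨g, hg, hgι⟩ := exists_colimit_desc hc Sigma.fst
    (fun j => components (B := K.obj j) (s.ι.app j)) (fun _ _ => rfl) (fun {j k} u i => by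
      rw [← components_map_comp]
      exact congrFun (congrArg components (s.w u)) i)
  obtain ⟨t, rfl⟩ := exists_components_eq g hg
  refine ⟨t, fun j => components_injective (funext fun i => ?_)⟩
  rw [components_map_comp, hgι]

lemma extend_colimit_hom_ext {J : Type} [SmallCategory J] {K : J ⥤ FinOver X}
    {c : Cocone K} (hc : IsColimit c) {a : A} {t t' : (extend ob).obj c.pt ⟶ a}
    (h : ∀ j, (extend ob).map (c.ι.app j) ≫ t = (extend ob).map (c.ι.app j) ≫ t') : t = t' := by
  refine components_injective (colimit_funext hc Sigma.fst (fun _ => rfl) (fun _ => rfl) ?_)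
  intro j i
  rw [← components_map_comp, ← components_map_comp, h]

lemma extend_preservesFiniteColimits : PreservesFiniteColimits (extend ob) where
  preservesFiniteColimits _ _ _ :=
    { preservesColimit :=
        { preserves := fun hc => ⟨
            { desc := fun s => (exists_extend_desc hc s).choose
              fac := fun s => (exists_extend_desc hc s).choose_spec
              uniq := fun s _ hm => extend_colimit_hom_ext hc fun j =>
                (hm j).trans ((exists_extend_desc hc s).choose_spec j).symm }⟩ } }

variable (ob) in
/-- The value of `extend ob` on a generator. -/
noncomputable def extendGenIso (x : X) : (extend ob).obj (gen x) ≅ ob x :=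
  coproductUniqueIso fun _ : PUnit => ob x

end FinOver

/-- `FinSet↓X` is the free category with finite colimits on the set `X`: any
assignment of objects of a finitely cocomplete category `A` to elements of `X`
extends to a finite-colimit-preserving functor `FinSet↓X ⥤ A`, with the value on the
generator `⟨x⟩` isomorphic to the assigned object. -/
theorem FinOver_free_extension {X : Type} {A : Type*} [Category A]
    [Limits.HasFiniteColimits A] (ob : X → A) :
    ∃ G : FinOver X ⥤ A, Nonempty (Limits.PreservesFiniteColimits G) ∧
      ∀ x : X, Nonempty (G.obj (FinOver.gen x) ≅ ob x) := by
  exact ⟨FinOver.extend ob, ⟨FinOver.extend_preservesFiniteColimits⟩,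
    fun x => ⟨FinOver.extendGenIso ob x⟩⟩
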